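/- Let (Γ, A) be an E-GCM graph with Coxeter group W and root system Φ, and for w ∈ W set N(w) = {α ∈ Φ⁺ : w.α ∈ Φ⁻}. For w ∈ W and i ∈ I: if w.α_i ∈ Φ⁺ then N(ws_i) = s_i(N(w)) ⊔ 𝔖(α_i) (a disjoint union); if w.α_i ∈ Φ⁻ then N(ws_i) = s_i(N(w) \ 𝔖(α_i)). -/

import Mathlib

open Real

variable {n : ℕ}

/-- E-generalized Cartan matrix: diagonal entries 2, off-diagonal entries nonpositive,
`a_{ij} = 0 ↔ a_{ji} = 0`, and each off-diagonal product is `≥ 4` or of the form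
`4cos²(π/k)` for an integer `k ≥ 2`. -/
def IsEGCM (A : Fin n → Fin n → ℝ) : Prop :=
  (∀ i, A i i = 2) ∧
  (∀ i j, i ≠ j → A i j ≤ 0) ∧
  (∀ i j, A i j = 0 → A j i = 0) ∧
  (∀ i j, i ≠ j → A i j * A j i ≥ 4 ∨
    ∃ k : ℕ, 2 ≤ k ∧ A i j * A j i = 4 * (Real.cos (Real.pi / k)) ^ 2)

/-- The Coxeter exponent `m_{ij}` (with `0` encoding `∞`). -/
noncomputable def mval (A : Fin n → Fin n → ℝ) (i j : Fin n) : ℕ :=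
  open scoped Classical in
  if h : ∃ k : ℕ, 2 ≤ k ∧ A i j * A j i = 4 * (Real.cos (Real.pi / k)) ^ 2
  then h.choose else 0

/-- The generating "reflection" `S_i(v) = v - 2B(α_i, v)α_i` where `B(α_i, α_j) = a_{ij}/2`
and the simple roots `α_i` are the standard basis vectors of `Fin n → ℝ`. -/
noncomputable def S (A : Fin n → Fin n → ℝ) (i : Fin n) : Function.End (Fin n → ℝ) :=
  fun v => v - (∑ j, A i j * v j) • (Pi.single i (1 : ℝ) : Fin n → ℝ)

/-- The representing group `σ(W)`, as the monoid generated by the reflections `S_i`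
(each `S_i` is an involution, so this is a group of transformations). -/
noncomputable def Wgrp (A : Fin n → Fin n → ℝ) : Submonoid (Function.End (Fin n → ℝ)) :=
  Submonoid.closure (Set.range (S A))

/-- The simple root `α_i`. -/
noncomputable def simple (i : Fin n) : Fin n → ℝ := Pi.single i 1

/-- The root system `Φ = {w.α_i}`. -/
noncomputable def Phi (A : Fin n → Fin n → ℝ) : Set (Fin n → ℝ) :=
  {v | ∃ w ∈ Wgrp A, ∃ i, w (simple i) = v}

/-- Positive roots. -/
noncomputable def PhiPos (A : Fin n → Fin n → ℝ) : Set (Fin n → ℝ) :=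
  {v | v ∈ Phi A ∧ ∀ j, 0 ≤ v j}

/-- Negative roots. -/
noncomputable def PhiNeg (A : Fin n → Fin n → ℝ) : Set (Fin n → ℝ) :=
  {v | v ∈ Phi A ∧ ∀ j, v j ≤ 0}

/-- `𝔖(α)`: the positive roots which are real scalar multiples of `α`. -/
noncomputable def Sfrak (A : Fin n → Fin n → ℝ) (α : Fin n → ℝ) : Set (Fin n → ℝ) :=
  {β | β ∈ PhiPos A ∧ ∃ K : ℝ, β = K • α}

/-- `N(w)`: the positive roots sent to negative roots by `w`. -/
noncomputable def Nset (A : Fin n → Fin n → ℝ) (w : Function.End (Fin n → ℝ)) :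
    Set (Fin n → ℝ) :=
  {α | α ∈ PhiPos A ∧ w α ∈ PhiNeg A}

/-- The Coxeter length of `w`: the least length of a word in the generators `S_i`
representing `w`. -/
noncomputable def len (A : Fin n → Fin n → ℝ) (w : Function.End (Fin n → ℝ)) : ℕ :=
  sInf {p | ∃ l : List (Fin n), l.length = p ∧ (l.map (S A)).prod = w}

/-- `γ_i` and `γ_j` are odd neighbors: `m_{ij}` is odd (in particular finite). -/
def OddNbr (A : Fin n → Fin n → ℝ) (i j : Fin n) : Prop := i ≠ j ∧ Odd (mval A i j)

/-- The scalar `K_{ji} = -a_{ji}/(2cos(π/m_{ij}))`. -/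
noncomputable def Kval (A : Fin n → Fin n → ℝ) (j i : Fin n) : ℝ :=
  -(A j i) / (2 * Real.cos (Real.pi / (mval A j i)))

/-- The scalar `Π_𝒫` attached to an ON-path `𝒫`: the product of the `K`'s along its steps. -/
noncomputable def pathProd (A : Fin n → Fin n → ℝ) : List (Fin n) → ℝ
  | [] => 1
  | [_] => 1
  | i :: j :: t => Kval A j i * pathProd A (j :: t)

/-- An ON-path: consecutive nodes are odd neighbors. -/
def IsONPath (A : Fin n → Fin n → ℝ) (l : List (Fin n)) : Prop := l.Chain' (OddNbr A)

/-- An ON-cycle: an ON-path of nonzero length whose start and end nodes coincide. -/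
def IsONCycle (A : Fin n → Fin n → ℝ) (l : List (Fin n)) : Prop :=
  IsONPath A l ∧ 2 ≤ l.length ∧ l.head? = l.getLast?

/-- `(Γ, A)` is unital ON-cyclic: `Π_𝒞 = 1` for every ON-cycle `𝒞`. -/
def UnitalONCyclic (A : Fin n → Fin n → ℝ) : Prop :=
  ∀ l : List (Fin n), IsONCycle A l → pathProd A l = 1

open CoxeterSystem (alternatingWord alternatingWord_succ alternatingWord_succ'
  length_alternatingWord)

/-! ### The reflections and the group they generate -/

lemma S_apply (A : Fin n → Fin n → ℝ) (i : Fin n) (v : Fin n → ℝ) :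
    S A i v = v - (∑ j, A i j * v j) • simple i := rfl

lemma S_isLinearMap (A : Fin n → Fin n → ℝ) (i : Fin n) : IsLinearMap ℝ (S A i) where
  map_add x y := by
    simp only [S_apply, Pi.add_apply, mul_add, Finset.sum_add_distrib]
    module
  map_smul c x := by
    have h : ∑ j, A i j * (c • x) j = c * ∑ j, A i j * x j := by
      rw [Finset.mul_sum]
      exact Finset.sum_congr rfl fun j _ => by simp only [Pi.smul_apply, smul_eq_mul]; ring
    rw [S_apply, S_apply, h]
    module

lemma S_simple (A : Fin n → Fin n → ℝ) (i j : Fin n) :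
    S A i (simple j) = simple j - A i j • simple i := by
  simp [S_apply, simple, Pi.single_apply]

lemma S_simple_self {A : Fin n → Fin n → ℝ} (hA : IsEGCM A) (i : Fin n) :
    S A i (simple i) = -simple i := by
  rw [S_simple, hA.1 i]
  module

lemma S_S {A : Fin n → Fin n → ℝ} (hA : IsEGCM A) (i : Fin n) (v : Fin n → ℝ) :
    S A i (S A i v) = v := by
  rw [S_apply A i v, (S_isLinearMap A i).map_sub, (S_isLinearMap A i).map_smul,
    S_simple_self hA, S_apply]
  module

lemma S_mul_S {A : Fin n → Fin n → ℝ} (hA : IsEGCM A) (i : Fin n) : S A i * S A i = 1 :=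
  funext (S_S hA i)

lemma S_mem_Wgrp (A : Fin n → Fin n → ℝ) (i : Fin n) : S A i ∈ Wgrp A :=
  Submonoid.subset_closure ⟨i, rfl⟩

lemma isLinearMap_of_mem_Wgrp {A : Fin n → Fin n → ℝ} {w : Function.End (Fin n → ℝ)}
    (hw : w ∈ Wgrp A) : IsLinearMap ℝ w := by
  induction hw using Submonoid.closure_induction with
  | mem x hx =>
    obtain ⟨i, rfl⟩ := hx
    exact S_isLinearMap A i
  | one => exact ⟨fun _ _ => rfl, fun _ _ => rfl⟩
  | mul x y _ _ hx hy =>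
    refine ⟨fun a b => ?_, fun c a => ?_⟩
    · change x (y (a + b)) = x (y a) + x (y b)
      rw [hy.map_add, hx.map_add]
    · change x (y (c • a)) = c • x (y a)
      rw [hy.map_smul, hx.map_smul]

lemma injective_of_mem_Wgrp {A : Fin n → Fin n → ℝ} (hA : IsEGCM A)
    {w : Function.End (Fin n → ℝ)} (hw : w ∈ Wgrp A) : Function.Injective w := by
  induction hw using Submonoid.closure_induction with
  | mem x hx =>
    obtain ⟨i, rfl⟩ := hx
    exact Function.LeftInverse.injective (S_S hA i)
  | one => exact fun _ _ h => h
  | mul x y _ _ hx hy => exact hx.comp hy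

lemma list_prod_mem_Wgrp (A : Fin n → Fin n → ℝ) (l : List (Fin n)) :
    (l.map (S A)).prod ∈ Wgrp A := by
  refine Submonoid.list_prod_mem _ fun x hx => ?_
  obtain ⟨i, -, rfl⟩ := List.mem_map.1 hx
  exact S_mem_Wgrp A i

/-! ### Length -/

lemma len_list_prod_le (A : Fin n → Fin n → ℝ) (l : List (Fin n)) :
    len A (l.map (S A)).prod ≤ l.length :=
  Nat.sInf_le ⟨l, rfl, rfl⟩

lemma exists_reduced_word {A : Fin n → Fin n → ℝ} {w : Function.End (Fin n → ℝ)}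
    (hw : w ∈ Wgrp A) :
    ∃ l : List (Fin n), l.length = len A w ∧ (l.map (S A)).prod = w := by
  have hne : {p | ∃ l : List (Fin n), l.length = p ∧ (l.map (S A)).prod = w}.Nonempty := by
    induction hw using Submonoid.closure_induction with
    | mem x hx =>
      obtain ⟨i, rfl⟩ := hx
      exact ⟨1, [i], rfl, by simp⟩
    | one => exact ⟨0, [], rfl, rfl⟩
    | mul x y _ _ hx hy =>
      obtain ⟨_, l, -, hl⟩ := hx
      obtain ⟨_, l', -, hl'⟩ := hy
      exact ⟨_, l ++ l', rfl, by simp [hl, hl']⟩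
  exact Nat.sInf_mem hne

/-! ### Chebyshev numbers -/

/-- The rescaled Chebyshev numbers `U₀ = 0`, `U₁ = 1`, `U_{m+2} = c U_{m+1} - U_m`. -/
noncomputable def chebU (c : ℝ) : ℕ → ℝ
  | 0 => 0
  | 1 => 1
  | m + 2 => c * chebU c (m + 1) - chebU c m

lemma chebU_nonneg_of_two_le {c : ℝ} (hc : 2 ≤ c) (m : ℕ) : 0 ≤ chebU c m := by
  suffices h : 0 ≤ chebU c m ∧ chebU c m ≤ chebU c (m + 1) from h.1
  induction m with
  | zero => simp [chebU]
  | succ m ih =>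
    refine ⟨ih.1.trans ih.2, ?_⟩
    rw [chebU]
    nlinarith [ih.1, ih.2]

lemma chebU_two_cos_mul_sin (θ : ℝ) (m : ℕ) :
    chebU (2 * cos θ) m * sin θ = sin (m * θ) := by
  induction m using Nat.twoStepInduction with
  | zero => simp [chebU]
  | one => simp [chebU]
  | more m ih₁ ih₂ =>
    have h₁ : ((m + 1 : ℕ) : ℝ) * θ = m * θ + θ := by push_cast; ring
    have h₂ : ((m + 2 : ℕ) : ℝ) * θ = m * θ + θ + θ := by push_cast; ring
    rw [h₁] at ih₂
    rw [chebU, sub_mul, mul_assoc, ih₁, ih₂, h₂, sin_add (m * θ + θ), cos_add, sin_add]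
    linear_combination sin (m * θ) * sin_sq_add_cos_sq θ

lemma sin_pi_div_pos {k : ℕ} (hk : 2 ≤ k) : 0 < sin (π / k) := by
  have hk' : (2 : ℝ) ≤ k := by exact_mod_cast hk
  exact sin_pos_of_pos_of_lt_pi (by positivity) (div_lt_self pi_pos (by linarith))

lemma cos_pi_div_nonneg {k : ℕ} (hk : 2 ≤ k) : 0 ≤ cos (π / k) := by
  have hk' : (2 : ℝ) ≤ k := by exact_mod_cast hk
  refine cos_nonneg_of_neg_pi_div_two_le_of_le ?_ ?_
  · have : 0 < π / k := by positivity
    linarith [pi_pos]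
  · exact div_le_div_of_nonneg_left pi_pos.le two_pos hk'

lemma chebU_two_cos_nonneg {k : ℕ} (hk : 2 ≤ k) {m : ℕ} (hm : m ≤ k) :
    0 ≤ chebU (2 * cos (π / k)) m := by
  have hk' : (0 : ℝ) < k := by exact_mod_cast (by omega : 0 < k)
  refine nonneg_of_mul_nonneg_left ?_ (sin_pi_div_pos hk)
  rw [chebU_two_cos_mul_sin]
  refine sin_nonneg_of_nonneg_of_le_pi (by positivity) ?_
  rw [← mul_div_assoc, div_le_iff₀ hk', mul_comm]
  have : (m : ℝ) ≤ k := by exact_mod_cast hm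
  gcongr

lemma chebU_two_cos_self {k : ℕ} (hk : 2 ≤ k) : chebU (2 * cos (π / k)) k = 0 := by
  have hk' : (k : ℝ) ≠ 0 := by exact_mod_cast (by omega : k ≠ 0)
  have h := chebU_two_cos_mul_sin (π / k) k
  rw [mul_div_cancel₀ _ hk', sin_pi] at h
  exact (mul_eq_zero.1 h).resolve_right (sin_pi_div_pos hk).ne'

lemma chebU_two_cos_succ {k : ℕ} (hk : 2 ≤ k) : chebU (2 * cos (π / k)) (k + 1) = -1 := by
  have hk' : (k : ℝ) ≠ 0 := by exact_mod_cast (by omega : k ≠ 0)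
  have h := chebU_two_cos_mul_sin (π / k) (k + 1)
  have e : ((k + 1 : ℕ) : ℝ) * (π / k) = π / k + π := by
    push_cast
    field_simp
    ring
  rw [e, sin_add_pi] at h
  exact mul_right_cancel₀ (sin_pi_div_pos hk).ne' (by linarith)

/-! ### Alternating products of two reflections -/

/-- The alternating product of `m` reflections `S_s`, `S_t` whose rightmost factor is `S_t`. -/
noncomputable def altProd (A : Fin n → Fin n → ℝ) (s t : Fin n) (m : ℕ) :
    Function.End (Fin n → ℝ) :=
  ((alternatingWord s t m).map (S A)).prod

lemma altProd_mem_Wgrp (A : Fin n → Fin n → ℝ) (s t : Fin n) (m : ℕ) :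
    altProd A s t m ∈ Wgrp A :=
  list_prod_mem_Wgrp A _

lemma altProd_zero (A : Fin n → Fin n → ℝ) (s t : Fin n) : altProd A s t 0 = 1 := rfl

lemma altProd_succ (A : Fin n → Fin n → ℝ) (s t : Fin n) (m : ℕ) :
    altProd A s t (m + 1) = altProd A t s m * S A t := by
  simp [altProd, alternatingWord_succ]

lemma altProd_succ' (A : Fin n → Fin n → ℝ) (s t : Fin n) (m : ℕ) :
    altProd A s t (m + 1) = S A (if Even m then t else s) * altProd A s t m := by
  simp [altProd, alternatingWord_succ']

lemma exists_altProd_add (A : Fin n → Fin n → ℝ) (s t : Fin n) (k d : ℕ) :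
    ∃ l : List (Fin n), l.length = d ∧
      altProd A s t (d + k) = (l.map (S A)).prod * altProd A s t k := by
  induction d with
  | zero => exact ⟨[], rfl, by simp⟩
  | succ d ih =>
    obtain ⟨l, hl, h⟩ := ih
    refine ⟨(if Even (d + k) then t else s) :: l, by simp [hl], ?_⟩
    rw [Nat.add_right_comm, altProd_succ', h, List.map_cons, List.prod_cons, mul_assoc]

/-- The simple roots `α_s` (even index) and `r α_t` (odd index). -/
noncomputable def altRoot (s t : Fin n) (r : ℝ) (m : ℕ) : Fin n → ℝ :=
  if Even m then simple s else r • simple t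

lemma altProd_simple {A : Fin n → Fin n → ℝ} (hA : IsEGCM A) {s t : Fin n} {c r : ℝ}
    (hts : A t s = -(r * c)) (hst : A s t * r = -c) (m : ℕ) :
    altProd A s t m (simple s) =
      chebU c (m + 1) • altRoot s t r m + chebU c m • altRoot s t r (m + 1) := by
  induction m with
  | zero =>
    simp only [chebU, altRoot, zero_add, Even.zero, if_true, one_smul, zero_smul, add_zero]
    rfl
  | succ m ih =>
    rw [altProd_succ']
    change S A _ (altProd A s t m (simple s)) = _
    rw [ih, (S_isLinearMap A _).map_add, (S_isLinearMap A _).map_smul,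
      (S_isLinearMap A _).map_smul, show m + 1 + 1 = m + 2 from rfl, chebU]
    by_cases hm : Even m
    · have h₁ : ¬ Even (m + 1) := by simpa [Nat.even_add_one] using hm
      have h₂ : Even (m + 2) := by simpa [Nat.even_add] using hm
      simp only [altRoot, hm, h₁, h₂, if_true, if_false]
      rw [(S_isLinearMap A t).map_smul, S_simple_self hA, S_simple, hts]
      module
    · have h₁ : Even (m + 1) := by simpa [Nat.even_add_one] using hm
      have h₂ : ¬ Even (m + 2) := by simpa [Nat.even_add] using hm
      simp only [altRoot, hm, h₁, h₂, if_true, if_false]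
      rw [(S_isLinearMap A s).map_smul, S_simple_self hA, S_simple, smul_sub, smul_smul r,
        mul_comm r, hst]
      module

lemma altProd_apply_eq_self {A : Fin n → Fin n → ℝ} {s t : Fin n} {z : Fin n → ℝ}
    (hs : S A s z = z) (ht : S A t z = z) (m : ℕ) : altProd A s t m z = z := by
  induction m with
  | zero => rfl
  | succ m ih =>
    rw [altProd_succ']
    change S A _ (altProd A s t m z) = z
    rw [ih]
    split_ifs <;> assumption

lemma altProd_simple_comm {A : Fin n → Fin n → ℝ} (hA : IsEGCM A) {s t : Fin n} {r : ℝ}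
    {k : ℕ} (hk : 2 ≤ k) (hts : A t s = -(r * (2 * cos (π / k))))
    (hst : A s t * r = -(2 * cos (π / k))) :
    altProd A s t k (simple s) = altProd A t s k (simple s) := by
  rw [altProd_simple hA hts hst, chebU_two_cos_self hk, chebU_two_cos_succ hk]
  obtain ⟨m, rfl⟩ : ∃ m, k = m + 1 := ⟨k - 1, by omega⟩
  rw [altProd_succ]
  change _ = altProd A s t m (S A s (simple s))
  rw [S_simple_self hA, (isLinearMap_of_mem_Wgrp (altProd_mem_Wgrp A s t m)).map_neg,
    altProd_simple hA hts hst, chebU_two_cos_self hk]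
  have h := chebU_two_cos_succ hk
  rw [show m + 1 + 1 = m + 2 from rfl, chebU, chebU_two_cos_self hk] at h
  rw [show chebU (2 * cos (π / (m + 1 : ℕ))) m = 1 by linarith]
  module

/-- The braid relation for two reflections whose Cartan product is `4 cos² (π / k)`. -/
lemma altProd_comm {A : Fin n → Fin n → ℝ} (hA : IsEGCM A) {s t : Fin n} {r : ℝ}
    {k : ℕ} (hk : 2 ≤ k) (hr : 0 < r) (hts : A t s = -(r * (2 * cos (π / k))))
    (hst : A s t * r = -(2 * cos (π / k))) :
    altProd A s t k = altProd A t s k := by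
  have hprod : A s t * A t s = 4 * cos (π / k) ^ 2 := by
    rw [hts]
    linear_combination (-(2 * cos (π / k))) * hst
  have hdet : 4 - A s t * A t s ≠ 0 := by
    have := sin_pi_div_pos hk
    have := sin_sq_add_cos_sq (π / k)
    rw [hprod]
    nlinarith
  have hcs := altProd_simple_comm hA hk hts hst
  have hct := altProd_simple_comm hA (s := t) (t := s) (r := r⁻¹) hk
    (by field_simp; linarith) (by rw [hts]; field_simp)
  funext v
  let f := ∑ j, A s j * v j
  let g := ∑ j, A t j * v j
  let x := (2 * f - A s t * g) / (4 - A s t * A t s)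
  let y := (2 * g - A t s * f) / (4 - A s t * A t s)
  have hxf : 2 * x + A s t * y = f := by
    simp only [x, y]
    rw [mul_div_assoc', mul_div_assoc', ← add_div, div_eq_iff hdet]
    ring
  have hyg : A t s * x + 2 * y = g := by
    simp only [x, y]
    rw [mul_div_assoc', mul_div_assoc', ← add_div, div_eq_iff hdet]
    ring
  let z := v - (x • simple s + y • simple t)
  have hv : v = z + (x • simple s + y • simple t) := by simp [z]
  have hzs : S A s z = z := by
    have hL := S_isLinearMap A s
    simp only [z]
    rw [hL.map_sub, hL.map_add, hL.map_smul, hL.map_smul, S_simple_self hA, S_simple, S_apply,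
      show ∑ j, A s j * v j = 2 * x + A s t * y from hxf.symm]
    module
  have hzt : S A t z = z := by
    have hL := S_isLinearMap A t
    simp only [z]
    rw [hL.map_sub, hL.map_add, hL.map_smul, hL.map_smul, S_simple_self hA, S_simple, S_apply,
      show ∑ j, A t j * v j = A t s * x + 2 * y from hyg.symm]
    module
  have h₁ := isLinearMap_of_mem_Wgrp (altProd_mem_Wgrp A s t k)
  have h₂ := isLinearMap_of_mem_Wgrp (altProd_mem_Wgrp A t s k)
  rw [hv, h₁.map_add, h₁.map_add, h₁.map_smul, h₁.map_smul, h₂.map_add, h₂.map_add,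
    h₂.map_smul, h₂.map_smul, altProd_apply_eq_self hzs hzt, altProd_apply_eq_self hzt hzs,
    hcs, hct]

/-- Rescaling parameters which symmetrize a rank-two Cartan matrix. -/
lemma exists_symmetrization {A : Fin n → Fin n → ℝ} (hA : IsEGCM A) {s t : Fin n}
    (hne : s ≠ t) :
    ∃ c r : ℝ, 0 < r ∧ A t s = -(r * c) ∧ A s t * r = -c ∧
      (2 ≤ c ∨ ∃ k : ℕ, 2 ≤ k ∧ c = 2 * cos (π / k)) := by
  obtain ⟨c, r, hc, hr, hts, hst⟩ : ∃ c r : ℝ, 0 ≤ c ∧ 0 < r ∧ A t s = -(r * c) ∧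
      A s t * r = -c := by
    rcases (hA.2.1 s t hne).eq_or_lt with h | h
    · exact ⟨0, 1, le_rfl, one_pos, by simp [hA.2.2.1 s t h], by simp [h]⟩
    · have h' : A t s < 0 := (hA.2.1 t s hne.symm).lt_of_ne
        fun h0 => h.ne (hA.2.2.1 t s h0)
      have hpos : 0 < A s t * A t s := mul_pos_of_neg_of_neg h h'
      have hsq := Real.mul_self_sqrt hpos.le
      have hc := Real.sqrt_pos.2 hpos
      refine ⟨√(A s t * A t s), -A t s / √(A s t * A t s), hc.le,
        div_pos (neg_pos.2 h') hc, by rw [div_mul_cancel₀ _ hc.ne', neg_neg], ?_⟩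
      field_simp
      linarith
  have hprod : A s t * A t s = c ^ 2 := by
    rw [hts]
    linear_combination (-c) * hst
  refine ⟨c, r, hr, hts, hst, (hA.2.2.2 s t hne).imp (fun h => ?_) ?_⟩
  · nlinarith
  · rintro ⟨k, hk, h⟩
    refine ⟨k, hk, ?_⟩
    have := cos_pi_div_nonneg hk
    exact (sq_eq_sq₀ hc (by positivity)).1 (by rw [← hprod, h]; ring)

/-- An alternating product sends `α_s` into the cone spanned by `α_s` and `α_t`, unless it is
long enough to be rewritten with `S_s` as its rightmost factor. -/
lemma altProd_simple_mem_cone_or_braid {A : Fin n → Fin n → ℝ} (hA : IsEGCM A)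
    {s t : Fin n} (hne : s ≠ t) (m : ℕ) :
    (∃ x y : ℝ, 0 ≤ x ∧ 0 ≤ y ∧
        altProd A s t m (simple s) = x • simple s + y • simple t) ∨
      ∃ k : ℕ, 2 ≤ k ∧ k ≤ m ∧ altProd A s t k = altProd A t s k := by
  obtain ⟨c, r, hr, hts, hst, hc⟩ := exists_symmetrization hA hne
  have key (h₁ : 0 ≤ chebU c (m + 1)) (h₂ : 0 ≤ chebU c m) : ∃ x y : ℝ, 0 ≤ x ∧ 0 ≤ y ∧
      altProd A s t m (simple s) = x • simple s + y • simple t := by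
    rw [altProd_simple hA hts hst]
    by_cases hm : Even m
    · refine ⟨_, _, h₁, mul_nonneg h₂ hr.le, ?_⟩
      simp [altRoot, hm, Nat.even_add_one, smul_smul]
    · refine ⟨_, _, h₂, mul_nonneg h₁ hr.le, ?_⟩
      simp [altRoot, hm, Nat.even_add_one, smul_smul, add_comm]
  rcases hc with hc | ⟨k, hk, rfl⟩
  · exact Or.inl (key (chebU_nonneg_of_two_le hc _) (chebU_nonneg_of_two_le hc _))
  · rcases lt_or_ge m k with hmk | hmk
    · exact Or.inl (key (chebU_two_cos_nonneg hk hmk) (chebU_two_cos_nonneg hk hmk.le))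
    · exact Or.inr ⟨k, hk, hmk, altProd_comm hA hk hr hts hst⟩

/-! ### Every root is positive or negative -/

lemma apply_simple_nonneg_of_len_le {A : Fin n → Fin n → ℝ} (hA : IsEGCM A)
    {w : Function.End (Fin n → ℝ)} (hw : w ∈ Wgrp A) (s : Fin n)
    (hs : len A w ≤ len A (w * S A s)) : ∀ j, 0 ≤ w (simple s) j := by
  induction hN : len A w using Nat.strong_induction_on generalizing w s with
  | _ N ih =>
  subst hN
  obtain ⟨l, hl, hlw⟩ := exists_reduced_word hw
  rcases List.eq_nil_or_concat l with rfl | ⟨l', t, rfl⟩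
  · obtain rfl : 1 = w := by simpa using hlw
    intro j
    change 0 ≤ (simple s : Fin n → ℝ) j
    rw [simple, Pi.single_apply]
    split_ifs <;> norm_num
  have hst : s ≠ t := by
    rintro rfl
    have h : w * S A s = (l'.map (S A)).prod := by
      rw [← hlw]
      simp [mul_assoc, S_mul_S hA]
    have := len_list_prod_le A l'
    simp only [List.concat_eq_append, List.length_append, List.length_singleton] at hl
    rw [h] at hs
    omega
  let P : ℕ → Prop := fun m => ∃ p : List (Fin n), p.length + m = len A w ∧
    (p.map (S A)).prod * altProd A s t m = w
  have hP₁ : P 1 := ⟨l', by simpa using hl, by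
    rw [← hlw, altProd_succ, altProd_zero]
    simp⟩
  obtain ⟨m, hm, ⟨p, hp, hpw⟩, hmax⟩ :
      ∃ m, 1 ≤ m ∧ P m ∧ ¬ P (m + 1) := by
    by_contra! hcon
    have hall : ∀ m, 1 ≤ m → P m := fun m hm => Nat.le_induction hP₁ hcon m hm
    obtain ⟨p, hp, -⟩ := hall (len A w + 1) (by omega)
    omega
  set v := (p.map (S A)).prod
  have hv : v ∈ Wgrp A := list_prod_mem_Wgrp A p
  have hvlen : len A v ≤ p.length := len_list_prod_le A p
  have shorten (p' q : List (Fin n)) (h : (p'.map (S A)).prod * (q.map (S A)).prod = w) :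
      len A w ≤ p'.length + q.length := by
    have := len_list_prod_le A (p' ++ q)
    rwa [List.map_append, List.prod_append, h, List.length_append] at this
  have ascent_outer : len A v ≤ len A (v * S A (if Even m then t else s)) := by
    by_contra! hlt
    obtain ⟨p', hp', hpv⟩ := exists_reduced_word
      (mul_mem hv (S_mem_Wgrp A (if Even m then t else s)))
    have hw' : (p'.map (S A)).prod * altProd A s t (m + 1) = w := by
      rw [hpv, altProd_succ', ← hpw, mul_assoc, ← mul_assoc (S A _) (S A _), S_mul_S hA,
        one_mul]
    have := shorten p' _ hw'
    rw [length_alternatingWord] at this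
    exact hmax ⟨p', by omega, hw'⟩
  have ascent_inner : len A v ≤ len A (v * S A (if Even m then s else t)) := by
    by_contra! hlt
    obtain ⟨p', hp', hpv⟩ := exists_reduced_word
      (mul_mem hv (S_mem_Wgrp A (if Even m then s else t)))
    obtain ⟨d, rfl⟩ : ∃ d, m = d + 1 := ⟨m - 1, by omega⟩
    have hw' : (p'.map (S A)).prod * altProd A s t d = w := by
      rw [hpv, ← hpw, altProd_succ', mul_assoc]
      by_cases hd : Even d <;> simp [hd, Nat.even_add_one]
    have := shorten p' _ hw'
    rw [length_alternatingWord] at this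
    omega
  have hvs : ∀ j, 0 ≤ v (simple s) j := by
    refine ih _ (by omega) hv s ?_ rfl
    by_cases h : Even m
    · simpa [h] using ascent_inner
    · simpa [h] using ascent_outer
  have hvt : ∀ j, 0 ≤ v (simple t) j := by
    refine ih _ (by omega) hv t ?_ rfl
    by_cases h : Even m
    · simpa [h] using ascent_outer
    · simpa [h] using ascent_inner
  rcases altProd_simple_mem_cone_or_braid hA hst m with ⟨x, y, hx, hy, hxy⟩ | ⟨k, hk, hkm, hbr⟩
  · intro j
    rw [← hpw]
    change 0 ≤ v (altProd A s t m (simple s)) j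
    have hL := isLinearMap_of_mem_Wgrp hv
    rw [hxy, hL.map_add, hL.map_smul, hL.map_smul]
    exact add_nonneg (mul_nonneg hx (hvs j)) (mul_nonneg hy (hvt j))
  · exfalso
    obtain ⟨q, hq, hqe⟩ := exists_altProd_add A s t k (m - k)
    rw [Nat.sub_add_cancel hkm, hbr] at hqe
    obtain ⟨d, rfl⟩ : ∃ d, k = d + 1 := ⟨k - 1, by omega⟩
    have hws : w * S A s = ((p ++ q ++ alternatingWord s t d).map (S A)).prod := by
      rw [← hpw, hqe, altProd_succ]
      simp [mul_assoc, S_mul_S hA, altProd, v]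
    have := len_list_prod_le A (p ++ q ++ alternatingWord s t d)
    rw [← hws] at this
    simp only [List.length_append, length_alternatingWord] at this
    omega

lemma neg_apply_simple {A : Fin n → Fin n → ℝ} (hA : IsEGCM A)
    {w : Function.End (Fin n → ℝ)} (hw : w ∈ Wgrp A) (i : Fin n) :
    (w * S A i) (simple i) = -w (simple i) := by
  change w (S A i (simple i)) = _
  rw [S_simple_self hA, (isLinearMap_of_mem_Wgrp hw).map_neg]

lemma nonneg_or_nonpos_of_mem_Phi {A : Fin n → Fin n → ℝ} (hA : IsEGCM A) {v : Fin n → ℝ}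
    (hv : v ∈ Phi A) : (∀ j, 0 ≤ v j) ∨ ∀ j, v j ≤ 0 := by
  obtain ⟨w, hw, i, rfl⟩ := hv
  rcases le_total (len A w) (len A (w * S A i)) with h | h
  · exact Or.inl (apply_simple_nonneg_of_len_le hA hw i h)
  · refine Or.inr fun j => ?_
    have h' := apply_simple_nonneg_of_len_le hA (mul_mem hw (S_mem_Wgrp A i)) i
      (by rwa [mul_assoc, S_mul_S hA, mul_one]) j
    rw [neg_apply_simple hA hw] at h'
    exact neg_nonneg.1 h'

lemma apply_mem_Phi {A : Fin n → Fin n → ℝ} {w : Function.End (Fin n → ℝ)}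
    (hw : w ∈ Wgrp A) {v : Fin n → ℝ} (hv : v ∈ Phi A) : w v ∈ Phi A := by
  obtain ⟨u, hu, i, rfl⟩ := hv
  exact ⟨w * u, mul_mem hw hu, i, rfl⟩

lemma ne_zero_of_mem_Phi {A : Fin n → Fin n → ℝ} (hA : IsEGCM A) {v : Fin n → ℝ}
    (hv : v ∈ Phi A) : v ≠ 0 := by
  obtain ⟨w, hw, i, rfl⟩ := hv
  intro h
  have h0 : (simple i : Fin n → ℝ) = 0 := injective_of_mem_Wgrp hA hw
    (h.trans (isLinearMap_of_mem_Wgrp hw).map_zero.symm)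
  simpa [simple] using congrFun h0 i

lemma disjoint_PhiPos_PhiNeg {A : Fin n → Fin n → ℝ} (hA : IsEGCM A) :
    Disjoint (PhiPos A) (PhiNeg A) :=
  Set.disjoint_left.2 fun _ hp hn =>
    ne_zero_of_mem_Phi hA hp.1 (funext fun j => le_antisymm (hn.2 j) (hp.2 j))

/-- `S_i` preserves the set of positive roots outside the line of `α_i`. -/
lemma S_mem_PhiPos_diff {A : Fin n → Fin n → ℝ} (hA : IsEGCM A) (i : Fin n) {v : Fin n → ℝ}
    (hv : v ∈ PhiPos A \ Sfrak A (simple i)) : S A i v ∈ PhiPos A \ Sfrak A (simple i) := by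
  obtain ⟨hpos, hS⟩ := hv
  have hPhi := apply_mem_Phi (S_mem_Wgrp A i) hpos.1
  refine ⟨⟨hPhi, (nonneg_or_nonpos_of_mem_Phi hA hPhi).resolve_right fun hneg => ?_⟩, ?_⟩
  · refine hS ⟨hpos, v i, funext fun j => ?_⟩
    by_cases hj : j = i
    · subst hj
      simp [simple]
    · have h := hneg j
      simp only [S_apply, Pi.sub_apply, Pi.smul_apply, simple, Pi.single_apply, hj, if_false,
        smul_zero, sub_zero] at h
      simpa [simple, Pi.single_apply, hj] using le_antisymm h (hpos.2 j)
  · rintro ⟨-, K, hK⟩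
    refine hS ⟨hpos, -K, ?_⟩
    rw [← S_S hA i v, hK, (S_isLinearMap A i).map_smul, S_simple_self hA]
    module

lemma exists_nonneg_of_mem_Sfrak {A : Fin n → Fin n → ℝ} {i : Fin n} {v : Fin n → ℝ}
    (hv : v ∈ Sfrak A (simple i)) : ∃ K : ℝ, 0 ≤ K ∧ v = K • simple i := by
  obtain ⟨hpos, K, rfl⟩ := hv
  exact ⟨K, by simpa [simple] using hpos.2 i, rfl⟩

lemma apply_mem_PhiPos_of_mem_Sfrak {A : Fin n → Fin n → ℝ} {w : Function.End (Fin n → ℝ)}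
    (hw : w ∈ Wgrp A) {i : Fin n} (hi : ∀ j, 0 ≤ w (simple i) j) {v : Fin n → ℝ}
    (hv : v ∈ Sfrak A (simple i)) : w v ∈ PhiPos A := by
  refine ⟨apply_mem_Phi hw hv.1.1, fun j => ?_⟩
  obtain ⟨K, hK, rfl⟩ := exists_nonneg_of_mem_Sfrak hv
  rw [(isLinearMap_of_mem_Wgrp hw).map_smul]
  exact mul_nonneg hK (hi j)

lemma apply_mem_PhiNeg_of_mem_Sfrak {A : Fin n → Fin n → ℝ} {w : Function.End (Fin n → ℝ)}
    (hw : w ∈ Wgrp A) {i : Fin n} (hi : ∀ j, w (simple i) j ≤ 0) {v : Fin n → ℝ}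
    (hv : v ∈ Sfrak A (simple i)) : w v ∈ PhiNeg A := by
  refine ⟨apply_mem_Phi hw hv.1.1, fun j => ?_⟩
  obtain ⟨K, hK, rfl⟩ := exists_nonneg_of_mem_Sfrak hv
  rw [(isLinearMap_of_mem_Wgrp hw).map_smul]
  exact mul_nonpos_of_nonneg_of_nonpos hK (hi j)

/-- Away from the line of `α_i`, `N(w s_i)` is the image of `N(w)` under `s_i`. -/
lemma Nset_mul_S_diff {A : Fin n → Fin n → ℝ} (hA : IsEGCM A)
    (w : Function.End (Fin n → ℝ)) (i : Fin n) :
    Nset A (w * S A i) \ Sfrak A (simple i) =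
      Set.image (S A i) (Nset A w \ Sfrak A (simple i)) := by
  ext v
  constructor
  · rintro ⟨⟨hv, hwv⟩, hS⟩
    have h := S_mem_PhiPos_diff hA i ⟨hv, hS⟩
    exact ⟨S A i v, ⟨⟨h.1, hwv⟩, h.2⟩, S_S hA i v⟩
  · rintro ⟨u, ⟨⟨hu, hwu⟩, hS⟩, rfl⟩
    have h := S_mem_PhiPos_diff hA i ⟨hu, hS⟩
    refine ⟨⟨h.1, ?_⟩, h.2⟩
    change w (S A i (S A i u)) ∈ PhiNeg A
    rwa [S_S hA]

/-- Lemma 3.8: for `w ∈ W` and `i ∈ I`: if `w.α_i ∈ Φ⁺` then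
`N(ws_i) = s_i(N(w)) ⊔ 𝔖(α_i)` (disjoint union); if `w.α_i ∈ Φ⁻` then
`N(ws_i) = s_i(N(w) \ 𝔖(α_i))`. -/
theorem stmt15 (A : Fin n → Fin n → ℝ) (hA : IsEGCM A)
    (w : Function.End (Fin n → ℝ)) (hw : w ∈ Wgrp A) (i : Fin n) :
    (w (simple i) ∈ PhiPos A →
      Nset A (w * S A i) = Set.image (S A i) (Nset A w) ∪ Sfrak A (simple i) ∧
      Disjoint (Set.image (S A i) (Nset A w)) (Sfrak A (simple i))) ∧
    (w (simple i) ∈ PhiNeg A →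
      Nset A (w * S A i) = Set.image (S A i) (Nset A w \ Sfrak A (simple i))) := by
  have hws := mul_mem hw (S_mem_Wgrp A i)
  constructor
  · intro hpos
    have hdisj : Disjoint (Nset A w) (Sfrak A (simple i)) := Set.disjoint_left.2
      fun v hv hS => Set.disjoint_left.1 (disjoint_PhiPos_PhiNeg hA)
        (apply_mem_PhiPos_of_mem_Sfrak hw hpos.2 hS) hv.2
    have hsub : Sfrak A (simple i) ⊆ Nset A (w * S A i) := fun v hv =>
      ⟨hv.1, apply_mem_PhiNeg_of_mem_Sfrak hws
        (fun j => by simpa [neg_apply_simple hA hw] using hpos.2 j) hv⟩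
    have himage : Set.image (S A i) (Nset A w) = Nset A (w * S A i) \ Sfrak A (simple i) := by
      rw [Nset_mul_S_diff hA, hdisj.sdiff_eq_left]
    rw [himage]
    exact ⟨(Set.sdiff_union_of_subset hsub).symm, Set.disjoint_sdiff_left⟩
  · intro hneg
    rw [← Nset_mul_S_diff hA]
    refine (Disjoint.sdiff_eq_left (Set.disjoint_left.2 fun v hv hS => ?_)).symm
    exact Set.disjoint_left.1 (disjoint_PhiPos_PhiNeg hA)
      (apply_mem_PhiPos_of_mem_Sfrak hws
        (fun j => by simpa [neg_apply_simple hA hw] using hneg.2 j) hS) hv.2
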